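/- arXiv:1311.3623 — 2 statements merged into one kernel-verified Lean document; each statement's English description precedes it below -/
import Mathlib

section
/- Let v and w be distinct nodes of T with A_d(v) > A_d(w). Then 2·A_d(v) − A_d(w) > B. (Interpretation: in the line embedding placing each node x at coordinate A_d(x), any walk from the root ρ that visits v before w has length at least A_d(v) + (A_d(v) − A_d(w)) > B; hence any non-adaptive policy on the line must visit vertices in nondecreasing distance from ρ.) -/
namespace StocOrient

/-- State along a root-to-node walk in the tree `T`:
current node's size `sz`, residual budget `bu`, distance traveled `dist`
(i.e. `A_d`), and size instantiated `inst` (i.e. `A_s`). -/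
structure St where
  sz : ℚ
  bu : ℚ
  dist : ℚ
  inst : ℚ

/-- One step from a node at level `lvl` to one of its children
(`true` = right child, `false` = left child); the child is at level `lvl - 1`. -/
def step (lvl : ℕ) (x : St) (dir : Bool) : St :=
  if dir then
    { sz := x.sz * (2 : ℚ) ^ ((2 : ℤ) ^ (lvl - 1)),
      bu := x.bu - x.sz,
      dist := x.dist,
      inst := x.inst + x.sz }
  else
    { sz := x.sz * (2 : ℚ) ^ (-((2 : ℤ) ^ (lvl - 1))),
      bu := x.sz,
      dist := x.dist + (x.bu - x.sz),
      inst := x.inst }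

def walkAux : ℕ → St → List Bool → St
  | _, x, [] => x
  | lvl, x, d :: rest => walkAux (lvl - 1) (step lvl x d) rest

/-- The budget `B = 2^(2^(L+1))`. -/
def Bq (L : ℕ) : ℚ := 2 ^ 2 ^ (L + 1)

/-- Data at the root: `s_ρ = 2^(2^L)`, `b(ρ) = B`, `A_d(ρ) = A_s(ρ) = 0`. -/
def start (L : ℕ) : St := ⟨2 ^ 2 ^ L, Bq L, 0, 0⟩

/-- A node of the tree `T` is identified with its root-to-node path
(`true` = right branch); nodes of `T` are exactly the paths of length `< L`. -/
def walk (L : ℕ) (v : List Bool) : St := walkAux L (start L) v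

/-- The size `s_v`. -/
def size (L : ℕ) (v : List Bool) : ℚ := (walk L v).sz

/-- The residual budget `b(v)`. -/
def budget (L : ℕ) (v : List Bool) : ℚ := (walk L v).bu

/-- `A_d(v)`: total edge length on the root-to-`v` path. -/
def Ad (L : ℕ) (v : List Bool) : ℚ := (walk L v).dist

/-- `A_s(v)`: total size of strict ancestors of `v` from which the path to `v`
goes right. -/
def As (L : ℕ) (v : List Bool) : ℚ := (walk L v).inst

/-- The level `ℓ(v)`: the root is at level `L`, the leaves at level `1`. -/
def level (L : ℕ) (v : List Bool) : ℕ := L - v.length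

end StocOrient

open StocOrient

namespace StocOrient

/-- The invariant satisfied by the state of every node at level `lvl`. -/
structure Inv (B : ℚ) (lvl : ℕ) (x : St) : Prop where
  sz_pos : 0 < x.sz
  inst_nonneg : 0 ≤ x.inst
  sum_eq : x.dist + x.bu + x.inst = B
  bu_ge : x.sz * 2 ^ 2 ^ lvl - x.sz / 2 ≤ x.bu
  inst_le : x.inst * 2 ^ 2 ^ lvl ≤ 2 * x.sz

lemma four_le_two_pow_two_pow {l : ℕ} (hl : 1 ≤ l) : (4 : ℚ) ≤ 2 ^ 2 ^ l := by
  have h : 2 ≤ 2 ^ l := by simpa using Nat.pow_le_pow_right (n := 2) (by norm_num) hl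
  calc (4 : ℚ) = 2 ^ 2 := by norm_num
    _ ≤ 2 ^ 2 ^ l := pow_le_pow_right₀ (by norm_num) h

lemma two_pow_two_pow_succ (l : ℕ) : (2 : ℚ) ^ 2 ^ (l + 1) = 2 ^ 2 ^ l * 2 ^ 2 ^ l := by
  rw [← pow_add, pow_succ, mul_two]

lemma zpow_two_pow (l : ℕ) : (2 : ℚ) ^ ((2 : ℤ) ^ l) = 2 ^ 2 ^ l := by
  rw [← zpow_natCast]
  push_cast
  rfl

lemma Inv.four_mul_sz_le {B : ℚ} {l : ℕ} {x : St} (h : Inv B l x) (hl : 1 ≤ l) :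
    4 * x.sz - x.sz / 2 ≤ x.bu := by
  have := mul_le_mul_of_nonneg_left (four_le_two_pow_two_pow hl) h.sz_pos.le
  linarith [h.bu_ge]

lemma Inv.four_mul_inst_le {B : ℚ} {l : ℕ} {x : St} (h : Inv B l x) (hl : 1 ≤ l) :
    4 * x.inst ≤ 2 * x.sz := by
  have := mul_le_mul_of_nonneg_left (four_le_two_pow_two_pow hl) h.inst_nonneg
  linarith [h.inst_le]

lemma inv_start (L : ℕ) : Inv (Bq L) L (start L) where
  sz_pos := by simp [start]
  inst_nonneg := le_rfl
  sum_eq := by simp [start]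
  bu_ge := by
    have : (0 : ℚ) < 2 ^ 2 ^ L := by positivity
    simp only [start, Bq, two_pow_two_pow_succ]
    linarith
  inst_le := by simp [start]

lemma Inv.step {B : ℚ} {l : ℕ} {x : St} (h : Inv B (l + 1) x) (hl : 1 ≤ l) (d : Bool) :
    Inv B l (step (l + 1) x d) := by
  have hi := h.four_mul_inst_le (by omega)
  obtain ⟨hs, hn, hsum, hb, hin⟩ := h
  have hq := four_le_two_pow_two_pow hl
  rw [two_pow_two_pow_succ] at hb hin
  cases d <;>
    simp only [StocOrient.step, Nat.add_sub_cancel, zpow_neg, zpow_two_pow, if_true,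
      Bool.false_eq_true, if_false]
  all_goals
    have hq0 : (0 : ℚ) < 2 ^ 2 ^ l := by positivity
    constructor <;> dsimp only <;> generalize (2 : ℚ) ^ 2 ^ l = q at *
  · positivity
  · exact hn
  · linarith
  · rw [inv_mul_cancel_right₀ hq0.ne']
    have : 0 < x.sz * q⁻¹ := by positivity
    linarith
  · rw [← mul_assoc, ← div_eq_mul_inv, le_div_iff₀ hq0]
    linarith
  · positivity
  · linarith
  · linarith
  · nlinarith
  · nlinarith

lemma Inv.dist_le_step {B : ℚ} {l : ℕ} {x : St} (h : Inv B l x) (hl : 1 ≤ l) (d : Bool) :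
    x.dist ≤ (StocOrient.step l x d).dist := by
  have := h.four_mul_sz_le hl
  have := h.sz_pos
  cases d <;> simp [StocOrient.step]
  linarith

lemma Inv.inst_le_step {B : ℚ} {l : ℕ} {x : St} (h : Inv B l x) (d : Bool) :
    x.inst ≤ (StocOrient.step l x d).inst := by
  cases d <;> simp [StocOrient.step, h.sz_pos.le]

lemma Inv.walkAux {B : ℚ} {v : List Bool} {l : ℕ} {x : St} (h : Inv B l x) (hv : v.length < l) :
    Inv B (l - v.length) (walkAux l x v) ∧ x.dist ≤ (StocOrient.walkAux l x v).dist ∧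
      x.inst ≤ (StocOrient.walkAux l x v).inst := by
  induction v generalizing l x with
  | nil => exact ⟨h, le_rfl, le_rfl⟩
  | cons d v ih =>
    rw [List.length_cons] at hv
    obtain ⟨l, rfl⟩ : ∃ k, l = k + 1 := ⟨l - 1, by omega⟩
    obtain ⟨h₁, h₂, h₃⟩ := ih (h.step (by omega) d) (by omega)
    rw [List.length_cons, Nat.add_sub_add_right]
    exact ⟨h₁, (h.dist_le_step (by omega) d).trans h₂, (h.inst_le_step d).trans h₃⟩

lemma Inv.lt_two_mul_dist_sub_dist {B : ℚ} {v w : List Bool} {l : ℕ} {x : St} (h : Inv B l x)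
    (hv : v.length < l) (hw : w.length < l)
    (hgt : (StocOrient.walkAux l x w).dist < (StocOrient.walkAux l x v).dist) :
    B < 2 * (StocOrient.walkAux l x v).dist - (StocOrient.walkAux l x w).dist := by
  induction v generalizing w l x with
  | nil => exact absurd hgt (h.walkAux hw).2.1.not_gt
  | cons d v ih =>
    rw [List.length_cons] at hv
    obtain ⟨l, rfl⟩ : ∃ k, l = k + 1 := ⟨l - 1, by omega⟩
    have hl : 1 ≤ l := by omega
    have hvl : v.length < l := by omega
    have hsum := h.sum_eq
    have hpos := h.sz_pos
    obtain ⟨hvi, hvd, hvn⟩ := (h.step hl d).walkAux hvl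
    cases w with
    | nil =>
      cases d with
      | true => exact ih (w := []) (h.step hl true) hvl hl hgt
      | false =>
        have hb := h.four_mul_sz_le (by omega)
        have hi := h.four_mul_inst_le (by omega)
        simp only [StocOrient.walkAux, StocOrient.step, Bool.false_eq_true, if_false,
          Nat.add_sub_cancel] at hvd ⊢
        linarith
    | cons e w =>
      rw [List.length_cons] at hw
      have hwl : w.length < l := by omega
      obtain ⟨hwi, hwd, hwn⟩ := (h.step hl e).walkAux hwl
      by_cases hde : d = e
      · subst hde
        exact ih (h.step hl d) hvl hwl hgt
      · change (StocOrient.walkAux l (StocOrient.step (l + 1) x e) w).dist <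
          (StocOrient.walkAux l (StocOrient.step (l + 1) x d) v).dist at hgt
        change B < 2 * (StocOrient.walkAux l (StocOrient.step (l + 1) x d) v).dist -
          (StocOrient.walkAux l (StocOrient.step (l + 1) x e) w).dist
        have hvb := hvi.four_mul_sz_le (by omega)
        have hvs := hvi.sum_eq
        have hvp := hvi.sz_pos
        have hwb := hwi.four_mul_sz_le (by omega)
        have hws := hwi.sum_eq
        have hwp := hwi.sz_pos
        have hwin := hwi.four_mul_inst_le (by omega)
        generalize StocOrient.walkAux l (StocOrient.step (l + 1) x d) v = y at *
        generalize StocOrient.walkAux l (StocOrient.step (l + 1) x e) w = z at *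
        cases d <;> cases e <;> simp [StocOrient.step] at hde hvd hvn hwd hwn <;> linarith

end StocOrient

/-- For distinct nodes `v` and `w` of `T` with `A_d(v) > A_d(w)`, we have
`2·A_d(v) - A_d(w) > B`: any walk from the root visiting `v` before `w`
travels more than the budget. -/
theorem stmt14 (L : ℕ) (hL : 2 ≤ L) (v w : List Bool)
    (hv : v.length < L) (hw : w.length < L) (hne : v ≠ w)
    (hgt : Ad L w < Ad L v) :
    Bq L < 2 * Ad L v - Ad L w := by
  exact (inv_start L).lt_two_mul_dist_sub_dist hv hw hgt
end

section
/- Let u and v be incomparable nodes of T (neither is an ancestor of the other) with A_d(u) ≤ A_d(v), and let w be u itself or any descendant of u. Then A_d(w) < A_d(v). (Interpretation: the blocking sets E_x — the set of previously visited nodes that are not ancestors of x — are nondecreasing along any non-adaptive policy that visits vertices in nondecreasing distance from the root.) -/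
open StocOrient

namespace StocOrient

/-- The residual budget at a node of level `lvl` is, up to one node size, at least the node size
times `2 ^ 2 ^ lvl`. -/
def BudgetBound (lvl : ℕ) (x : St) : Prop :=
  0 < x.sz ∧ x.sz * (2 ^ 2 ^ lvl - 1) ≤ x.bu

theorem two_le_two_pow_two_pow (n : ℕ) : (2 : ℚ) ≤ 2 ^ 2 ^ n :=
  le_self_pow₀ (by norm_num) (by positivity)

theorem BudgetBound.bu_pos {lvl : ℕ} {x : St} (h : BudgetBound lvl x) : 0 < x.bu :=
  lt_of_lt_of_le (mul_pos h.1 (by linarith [two_le_two_pow_two_pow lvl])) h.2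

theorem BudgetBound.sz_le_bu {lvl : ℕ} {x : St} (h : BudgetBound lvl x) : x.sz ≤ x.bu :=
  (le_mul_of_one_le_right h.1.le (by linarith [two_le_two_pow_two_pow lvl])).trans h.2

theorem BudgetBound.child {n : ℕ} {x : St} (h : BudgetBound (n + 1) x) (dir : Bool) :
    BudgetBound n (step (n + 1) x dir) := by
  obtain ⟨hs, hb⟩ := h
  have hX := two_le_two_pow_two_pow n
  have hz : (2 : ℚ) ^ ((2 : ℤ) ^ n) = 2 ^ 2 ^ n := by
    rw [← zpow_natCast]; push_cast; rfl
  rw [pow_succ 2 n, pow_mul] at hb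
  cases dir
  · simp only [BudgetBound, step, Bool.false_eq_true, if_false, Nat.add_sub_cancel,
      zpow_neg, hz]
    refine ⟨by positivity, ?_⟩
    rw [mul_assoc, mul_sub, inv_mul_cancel₀ (by positivity)]
    have : (0 : ℚ) < (2 ^ 2 ^ n)⁻¹ := by positivity
    nlinarith
  · simp only [BudgetBound, step, if_true, Nat.add_sub_cancel, hz]
    refine ⟨by positivity, ?_⟩
    nlinarith

theorem budgetBound_start (L : ℕ) : BudgetBound L (start L) := by
  refine ⟨by simp [start], ?_⟩
  have : (0 : ℚ) < 2 ^ 2 ^ L := by positivity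
  simp only [start, Bq, pow_succ 2 L, pow_mul]
  nlinarith

theorem dist_le_dist_walkAux {v : List Bool} {lvl : ℕ} {x : St} (h : BudgetBound lvl x)
    (hv : v.length < lvl) : x.dist ≤ (walkAux lvl x v).dist := by
  induction v generalizing lvl x with
  | nil => exact le_rfl
  | cons a v ih =>
    obtain ⟨n, rfl⟩ : ∃ n, lvl = n + 1 := ⟨lvl - 1, by omega⟩
    refine le_trans ?_ (ih (h.child a) (by simpa using hv))
    have := h.sz_le_bu
    cases a <;> simp [step, this]

theorem dist_walkAux_lt {v : List Bool} {lvl : ℕ} {x : St} (h : BudgetBound lvl x)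
    (hv : v.length < lvl) : (walkAux lvl x v).dist < x.dist + x.bu := by
  induction v generalizing lvl x with
  | nil => exact lt_add_of_pos_right _ h.bu_pos
  | cons a v ih =>
    obtain ⟨n, rfl⟩ : ∃ n, lvl = n + 1 := ⟨lvl - 1, by omega⟩
    refine (ih (h.child a) (by simpa using hv)).trans_le ?_
    have := h.1
    cases a <;> simp only [step, Bool.false_eq_true, if_false, if_true] <;> linarith

/-- Every node of the right subtree is strictly closer to the root than every node of the
left subtree. -/
theorem dist_right_lt_dist_left {u v : List Bool} {lvl : ℕ} {x : St} (h : BudgetBound lvl x)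
    (hu : u.length + 1 < lvl) (hv : v.length + 1 < lvl) :
    (walkAux lvl x (true :: u)).dist < (walkAux lvl x (false :: v)).dist := by
  obtain ⟨n, rfl⟩ : ∃ n, lvl = n + 1 := ⟨lvl - 1, by omega⟩
  have hr := dist_walkAux_lt (h.child true) (Nat.lt_of_succ_lt_succ hu)
  have hl := dist_le_dist_walkAux (h.child false) (Nat.lt_of_succ_lt_succ hv)
  refine lt_of_lt_of_le hr (le_of_eq_of_le ?_ hl)
  simp [step]

theorem dist_walkAux_append_lt {u v t : List Bool} {lvl : ℕ} {x : St} (h : BudgetBound lvl x)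
    (hv : v.length < lvl) (hw : (u ++ t).length < lvl) (h1 : ¬ u <+: v) (h2 : ¬ v <+: u)
    (hle : (walkAux lvl x u).dist ≤ (walkAux lvl x v).dist) :
    (walkAux lvl x (u ++ t)).dist < (walkAux lvl x v).dist := by
  induction u generalizing v lvl x with
  | nil => exact absurd List.nil_prefix h1
  | cons a u ih =>
    cases v with
    | nil => exact absurd List.nil_prefix h2
    | cons b v =>
      obtain ⟨n, rfl⟩ : ∃ n, lvl = n + 1 := ⟨lvl - 1, by omega⟩
      have hu : u.length + 1 < n + 1 := by simp at hw; omega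
      by_cases hab : a = b
      · subst hab
        exact ih (h.child a) (by simpa using hv) (by simpa using hw)
          (by simpa using h1) (by simpa using h2) hle
      · cases a <;> cases b
        · exact absurd rfl hab
        · exact absurd hle (not_le.mpr (dist_right_lt_dist_left h hv hu))
        · exact dist_right_lt_dist_left h hw hv
        · exact absurd rfl hab

end StocOrient

/-- If `u` and `v` are incomparable nodes of `T` (neither is an ancestor of
the other) with `A_d(u) ≤ A_d(v)`, and `w` is `u` itself or any descendant
of `u`, then `A_d(w) < A_d(v)`. -/
theorem stmt17 (L : ℕ) (hL : 2 ≤ L) (u v w : List Bool)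
    (hu : u.length < L) (hv : v.length < L) (hw : w.length < L)
    (h1 : ¬ u <+: v) (h2 : ¬ v <+: u) (hle : Ad L u ≤ Ad L v)
    (hdesc : u <+: w) :
    Ad L w < Ad L v := by
  obtain ⟨t, rfl⟩ := hdesc
  exact dist_walkAux_append_lt (budgetBound_start L) hv hw h1 h2 hle
end
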